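/- Let ℐ ⊆ 𝒥 be an isotropic subspace and for each t ∈ ℝ let V_t := {J(t) : J ∈ ℐ} + {J'(t) : J ∈ ℐ, J(t) = 0}. If a Jacobi field J ∈ 𝒥 satisfies ω(J, J̃) = 0 for every J̃ ∈ ℐ (i.e. J lies in the symplectic orthogonal ℐ^ω) and J(t) ∈ V_t for every t ∈ ℝ (i.e. J is everywhere vertical), then J ∈ ℐ. (Equivalently, the kernel of the horizontal projection restricted to ℐ^ω is exactly ℐ.) -/

import Mathlib

open scoped RealInnerProductSpace

noncomputable section

/-- Euclidean space `ℝ^n`. -/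
abbrev Euc (n : ℕ) := EuclideanSpace ℝ (Fin n)

/-- `J : ℝ → ℝ^n` is a Jacobi field for the curvature family `R`:
it is twice differentiable and satisfies `J'' + R J = 0`. -/
def IsJacobi {n : ℕ} (R : ℝ → (Euc n →L[ℝ] Euc n)) (J : ℝ → Euc n) : Prop :=
  Differentiable ℝ J ∧ Differentiable ℝ (deriv J) ∧
    ∀ t : ℝ, deriv (deriv J) t + R t (J t) = 0

/-- The (candidate) symplectic pairing of two fields, evaluated at time `t`. -/
def om {n : ℕ} (J₁ J₂ : ℝ → Euc n) (t : ℝ) : ℝ :=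
  ⟪deriv J₁ t, J₂ t⟫ - ⟪J₁ t, deriv J₂ t⟫

/-- The fiber at time `t` of the vertical bundle associated with a space `I` of
Jacobi fields: `I(t) + D(I_t⁰)(t)`. -/
def vertFib {n : ℕ} (I : Submodule ℝ (ℝ → Euc n)) (t : ℝ) : Set (Euc n) :=
  {v | ∃ J ∈ I, ∃ J' ∈ I, J' t = 0 ∧ v = J t + deriv J' t}

/-- A Jacobi field satisfies the first-order form of the Jacobi equation. -/
lemma IsJacobi.hasDerivAt_deriv {n : ℕ} {R : ℝ → (Euc n →L[ℝ] Euc n)} {J : ℝ → Euc n}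
    (hJ : IsJacobi R J) (t : ℝ) : HasDerivAt (deriv J) (-R t (J t)) t := by
  rw [← eq_neg_of_add_eq_zero_left (hJ.2.2 t)]
  exact (hJ.2.1 t).hasDerivAt

lemma deriv_add_of_isJacobi {n : ℕ} {R : ℝ → (Euc n →L[ℝ] Euc n)} {J₁ J₂ : ℝ → Euc n}
    (h₁ : IsJacobi R J₁) (h₂ : IsJacobi R J₂) : deriv (J₁ + J₂) = deriv J₁ + deriv J₂ :=
  funext fun t => deriv_add (h₁.1 t) (h₂.1 t)

lemma deriv_smul_of_isJacobi {n : ℕ} {R : ℝ → (Euc n →L[ℝ] Euc n)} {J : ℝ → Euc n}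
    (h : IsJacobi R J) (c : ℝ) : deriv (c • J) = c • deriv J :=
  funext fun t => deriv_const_smul c (h.1 t)

/-- The space of all Jacobi fields of `R`. -/
def jacobiFields {n : ℕ} (R : ℝ → (Euc n →L[ℝ] Euc n)) : Submodule ℝ (ℝ → Euc n) where
  carrier := {J | IsJacobi R J}
  zero_mem' := by
    have h : deriv (0 : ℝ → Euc n) = 0 := deriv_zero
    refine ⟨differentiable_zero, ?_, fun t => ?_⟩ <;> rw [h]
    · exact differentiable_zero
    · simp [h]
  add_mem' := by
    intro J₁ J₂ h₁ h₂
    refine ⟨h₁.1.add h₂.1, ?_, fun t => ?_⟩ <;> rw [deriv_add_of_isJacobi h₁ h₂]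
    · exact h₁.2.1.add h₂.2.1
    · rw [deriv_add (h₁.2.1 t) (h₂.2.1 t), Pi.add_apply, map_add, add_add_add_comm,
        h₁.2.2 t, h₂.2.2 t, add_zero]
  smul_mem' := by
    intro c J h
    refine ⟨h.1.const_smul c, ?_, fun t => ?_⟩ <;> rw [deriv_smul_of_isJacobi h]
    · exact h.2.1.const_smul c
    · rw [deriv_const_smul c (h.2.1 t), Pi.smul_apply, map_smul, ← smul_add, h.2.2 t, smul_zero]

/-- A Jacobi field with vanishing initial data vanishes identically. -/
lemma IsJacobi.eq_zero {n : ℕ} {R : ℝ → (Euc n →L[ℝ] Euc n)} (hR : Continuous R)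
    {J : ℝ → Euc n} (hJ : IsJacobi R J) (h₀ : J 0 = 0) (h₁ : deriv J 0 = 0) : J = 0 := by
  funext t
  let L : ℝ → (Euc n × Euc n →L[ℝ] Euc n × Euc n) := fun s =>
    (ContinuousLinearMap.snd ℝ (Euc n) (Euc n)).prod
      (-(R s).comp (ContinuousLinearMap.fst ℝ (Euc n) (Euc n)))
  have hL : Continuous L :=
    (ContinuousLinearMap.prodₗᵢ ℝ).continuous.comp
      (continuous_const.prodMk (hR.clm_comp continuous_const).neg)
  obtain ⟨C, hC⟩ := (isCompact_Icc (a := -(|t| + 1)) (b := |t| + 1)).exists_bound_of_continuousOn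
    hL.continuousOn
  have hLip : ∀ s ∈ Set.Ioo (-(|t| + 1)) (|t| + 1),
      LipschitzOnWith C.toNNReal (L s) Set.univ := by
    intro s hs
    refine ((L s).lipschitz.weaken ?_).lipschitzOnWith
    exact NNReal.le_toNNReal_of_coe_le (hC s (Set.Ioo_subset_Icc_self hs))
  have heq := ODE_solution_unique_of_mem_Ioo (t₀ := 0) (f := fun s => (J s, deriv J s))
    (g := fun _ => 0) hLip ⟨by linarith [abs_nonneg t], by positivity⟩
    (fun s _ => ⟨(hJ.1 s).hasDerivAt.prodMk (hJ.hasDerivAt_deriv s), trivial⟩)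
    (fun s _ => ⟨by rw [map_zero]; exact hasDerivAt_const s 0, trivial⟩)
    (Prod.ext h₀ h₁)
  exact congrArg Prod.fst (heq ⟨by linarith [neg_abs_le t], by linarith [le_abs_self t]⟩)

/-- The symplectic pairing of two Jacobi fields is constant in time. -/
lemma om_eq_om_zero {n : ℕ} {R : ℝ → (Euc n →L[ℝ] Euc n)}
    (hR : ∀ t : ℝ, ∀ v w : Euc n, ⟪R t v, w⟫ = ⟪v, R t w⟫) {J₁ J₂ : ℝ → Euc n}
    (h₁ : IsJacobi R J₁) (h₂ : IsJacobi R J₂) (t : ℝ) : om J₁ J₂ t = om J₁ J₂ 0 := by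
  have hd : ∀ s, HasDerivAt (om J₁ J₂) 0 s := by
    intro s
    have := ((h₁.hasDerivAt_deriv s).inner ℝ (h₂.1 s).hasDerivAt).sub
      ((h₁.1 s).hasDerivAt.inner ℝ (h₂.hasDerivAt_deriv s))
    refine HasDerivAt.congr_deriv (f := om J₁ J₂) this ?_
    simp only [inner_neg_left, inner_neg_right, hR]
    ring
  exact is_const_of_deriv_eq_zero (fun s => (hd s).differentiableAt) (fun s => (hd s).deriv) t 0

/-- The evaluation of initial data `J ↦ (J 0, J' 0)` on Jacobi fields. -/
def initialData {n : ℕ} (R : ℝ → (Euc n →L[ℝ] Euc n)) : jacobiFields R →ₗ[ℝ] Euc n × Euc n where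
  toFun J := (J.1 0, deriv J.1 0)
  map_add' J₁ J₂ := by
    simp [deriv_add_of_isJacobi J₁.2 J₂.2]
  map_smul' c J := by
    simp [deriv_smul_of_isJacobi J.2]

lemma finiteDimensional_jacobiFields {n : ℕ} {R : ℝ → (Euc n →L[ℝ] Euc n)} (hR : Continuous R) :
    FiniteDimensional ℝ (jacobiFields R) := by
  refine FiniteDimensional.of_injective (initialData R) ((injective_iff_map_eq_zero _).2 ?_)
  intro J hJ
  have h := Prod.ext_iff.1 hJ
  exact Subtype.ext (J.2.eq_zero hR h.1 h.2)

open Filter Topology in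
/-- On an isotropic space of Jacobi fields, evaluation at some time is injective. -/
lemma exists_forall_eq_zero_of_isotropic {n : ℕ} {R : ℝ → (Euc n →L[ℝ] Euc n)}
    (hRcont : Continuous R) (hRsym : ∀ t : ℝ, ∀ v w : Euc n, ⟪R t v, w⟫ = ⟪v, R t w⟫)
    {I : Submodule ℝ (ℝ → Euc n)} (hIJ : I ≤ jacobiFields R)
    (hiso : ∀ J₁ ∈ I, ∀ J₂ ∈ I, om J₁ J₂ 0 = 0) :
    ∃ t : ℝ, ∀ X ∈ I, X t = 0 → X = 0 := by
  have := finiteDimensional_jacobiFields hRcont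
  have : FiniteDimensional ℝ I := Submodule.finiteDimensional_of_le hIJ
  let b := Module.finBasis ℝ I
  let F : (Fin (Module.finrank ℝ I) → ℝ) → ℝ → Euc n := fun c => ∑ i, c i • (b i : ℝ → Euc n)
  have hFI : ∀ c, F c ∈ I := fun c => I.sum_mem fun i _ => I.smul_mem _ (b i).2
  have hF0 : ∀ c, F c = 0 → c = 0 := by
    intro c hc
    have h : ∑ i, c i • b i = 0 := Subtype.ext (by simpa [F] using hc)
    exact funext (Fintype.linearIndependent_iff.1 b.linearIndependent c h)
  have hFsurj : ∀ X ∈ I, ∃ c, F c = X := by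
    intro X hX
    refine ⟨b.repr ⟨X, hX⟩, ?_⟩
    simpa only [Submodule.coe_sum, Submodule.coe_smul] using
      congrArg Subtype.val (b.sum_repr ⟨X, hX⟩)
  have hFsmul : ∀ (a : ℝ) c, F (a • c) = a • F c := by
    intro a c
    simp [F, Finset.smul_sum, mul_smul]
  have hb : ∀ i, IsJacobi R (b i : ℝ → Euc n) := fun i => hIJ (b i).2
  have hFderiv : ∀ c t, deriv (F c) t = ∑ i, c i • deriv (b i : ℝ → Euc n) t := by
    intro c t
    exact (HasDerivAt.sum fun i _ => ((hb i).1 t).hasDerivAt.const_smul (c i)).deriv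
  have hFcont : Continuous fun p : (Fin (Module.finrank ℝ I) → ℝ) × ℝ => F p.1 p.2 := by
    have : ∀ i, Continuous (b i : ℝ → Euc n) := fun i => (hb i).1.continuous
    simp only [F, Finset.sum_apply, Pi.smul_apply]
    fun_prop
  have hF'cont :
      Continuous fun p : (Fin (Module.finrank ℝ I) → ℝ) × ℝ => deriv (F p.1) p.2 := by
    have : ∀ i, Continuous (deriv (b i : ℝ → Euc n)) := fun i => (hb i).2.1.continuous
    simp only [hFderiv]
    fun_prop
  by_contra! hcon
  have hex : ∀ t : ℝ, ∃ c ∈ Metric.sphere (0 : Fin (Module.finrank ℝ I) → ℝ) 1, F c t = 0 := by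
    intro t
    obtain ⟨X, hX, hXt, hX0⟩ := hcon t
    obtain ⟨c, rfl⟩ := hFsurj X hX
    have hc : c ≠ 0 := by
      rintro rfl
      exact hX0 (by simp [F])
    refine ⟨‖c‖⁻¹ • c, ?_, ?_⟩
    · simp [norm_smul, hc]
    · rw [hFsmul, Pi.smul_apply, hXt, smul_zero]
  choose c hcS hc0 using hex
  obtain ⟨a, ha, φ, hφ, hlim⟩ :=
    (isCompact_sphere (0 : Fin (Module.finrank ℝ I) → ℝ) 1).tendsto_subseq
      (x := fun k : ℕ => c (1 / ((k : ℝ) + 1))) (fun k => hcS _)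
  let t : ℕ → ℝ := fun k => 1 / ((φ k : ℝ) + 1)
  have htne : ∀ k, t k ≠ 0 := fun k => by positivity
  have ht : Tendsto t atTop (𝓝 0) :=
    (tendsto_one_div_add_atTop_nhds_zero_nat (𝕜 := ℝ)).comp hφ.tendsto_atTop
  have hct : Tendsto (fun k => (c (t k), t k)) atTop (𝓝 (a, 0)) := hlim.prodMk_nhds ht
  have ha0 : F a 0 = 0 := by
    refine tendsto_nhds_unique ((hFcont.tendsto (a, 0)).comp hct) ?_
    simp [Function.comp_def, hc0]
  have hslope : Tendsto (fun k => (t k)⁻¹ • F a (t k)) atTop (𝓝 (deriv (F a) 0)) := by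
    have h := hasDerivAt_iff_tendsto_slope.1 ((hIJ (hFI a)).1 0).hasDerivAt
    have := h.comp (tendsto_nhdsWithin_iff.2 ⟨ht, Eventually.of_forall htne⟩)
    simpa [Function.comp_def, slope_def_module, ha0] using this
  have hinner : ∀ k, ⟪deriv (F (c (t k))) (t k), (t k)⁻¹ • F a (t k)⟫ = 0 := by
    intro k
    have h := om_eq_om_zero hRsym (hIJ (hFI (c (t k)))) (hIJ (hFI a)) (t k)
    rw [hiso _ (hFI _) _ (hFI _), om, hc0, inner_zero_left, sub_zero] at h
    rw [inner_smul_right, h, mul_zero]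
  have ha1 : deriv (F a) 0 = 0 := by
    have h := Tendsto.inner (𝕜 := ℝ) ((hF'cont.tendsto (a, 0)).comp hct) hslope
    simp only [Function.comp_def, hinner] at h
    exact inner_self_eq_zero.1 (tendsto_nhds_unique h tendsto_const_nhds)
  have : a = 0 := hF0 a ((hIJ (hFI a)).eq_zero hRcont ha0 ha1)
  simp [this] at ha

lemma om_add_smul_add_smul {n : ℕ} {R : ℝ → (Euc n →L[ℝ] Euc n)} {A B J : ℝ → Euc n}
    (hA : IsJacobi R A) (hB : IsJacobi R B) (hJ : IsJacobi R J) (r s t : ℝ) :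
    om (A + r • J) (B + s • J) t = om A B t - s * om J A t + r * om J B t := by
  have hr : IsJacobi R (r • J) := (jacobiFields R).smul_mem r hJ
  have hs : IsJacobi R (s • J) := (jacobiFields R).smul_mem s hJ
  simp only [om, deriv_add_of_isJacobi hA hr, deriv_add_of_isJacobi hB hs,
    deriv_smul_of_isJacobi hJ, Pi.add_apply, Pi.smul_apply, inner_add_left, inner_add_right,
    real_inner_smul_left, real_inner_smul_right]
  rw [real_inner_comm (deriv A t) (J t), real_inner_comm (A t) (deriv J t),
    real_inner_comm (J t) (deriv J t)]
  ring

theorem stmt_16 {n : ℕ} (hn : 1 ≤ n) (R : ℝ → (Euc n →L[ℝ] Euc n))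
    (hRcont : Continuous R)
    (hRsym : ∀ t : ℝ, ∀ v w : Euc n, ⟪R t v, w⟫ = ⟪v, R t w⟫)
    (ℐ : Submodule ℝ (ℝ → Euc n))
    (hℐJ : ∀ J ∈ ℐ, IsJacobi R J)
    (hiso : ∀ J₁ ∈ ℐ, ∀ J₂ ∈ ℐ, om J₁ J₂ 0 = 0)
    (J : ℝ → Euc n) (hJ : IsJacobi R J)
    (hperp : ∀ J' ∈ ℐ, om J J' 0 = 0)
    (hvert : ∀ t : ℝ, J t ∈ vertFib ℐ t) :
    J ∈ ℐ := by
  have hspan : ∀ X ∈ ℐ ⊔ Submodule.span ℝ {J}, ∃ A ∈ ℐ, ∃ r : ℝ, X = A + r • J := by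
    intro X hX
    obtain ⟨A, hA, Y, hY, rfl⟩ := Submodule.mem_sup.1 hX
    obtain ⟨r, rfl⟩ := Submodule.mem_span_singleton.1 hY
    exact ⟨A, hA, r, rfl⟩
  have hle : ℐ ⊔ Submodule.span ℝ {J} ≤ jacobiFields R :=
    sup_le hℐJ ((Submodule.span_singleton_le_iff_mem _ _).2 hJ)
  have hiso' : ∀ X ∈ ℐ ⊔ Submodule.span ℝ {J}, ∀ Y ∈ ℐ ⊔ Submodule.span ℝ {J},
      om X Y 0 = 0 := by
    intro X hX Y hY
    obtain ⟨A, hA, r, rfl⟩ := hspan X hX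
    obtain ⟨B, hB, s, rfl⟩ := hspan Y hY
    rw [om_add_smul_add_smul (hℐJ A hA) (hℐJ B hB) hJ, hiso A hA B hB, hperp A hA, hperp B hB]
    ring
  obtain ⟨t, ht⟩ := exists_forall_eq_zero_of_isotropic hRcont hRsym hle hiso'
  obtain ⟨A, hA, B, hB, hBt, hJt⟩ := hvert t
  have hJB : ⟪J t, deriv B t⟫ = 0 := by
    have h := om_eq_om_zero hRsym hJ (hℐJ B hB) t
    rwa [hperp B hB, om, hBt, inner_zero_right, zero_sub, neg_eq_zero] at h
  have hAB : ⟪A t, deriv B t⟫ = 0 := by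
    have h := om_eq_om_zero hRsym (hℐJ A hA) (hℐJ B hB) t
    rwa [hiso A hA B hB, om, hBt, inner_zero_right, zero_sub, neg_eq_zero] at h
  have hB' : deriv B t = 0 := by
    rw [hJt, inner_add_left, hAB, zero_add] at hJB
    exact inner_self_eq_zero.1 hJB
  have hJA : J - A = 0 := by
    refine ht _ (sub_mem (Submodule.mem_sup_right (Submodule.mem_span_singleton_self J))
      (Submodule.mem_sup_left hA)) ?_
    rw [Pi.sub_apply, hJt, hB', add_zero, sub_self]
  rwa [sub_eq_zero.1 hJA]
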